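/- arXiv:2303.10463 — 2 statements merged into one kernel-verified Lean document; each statement's English description precedes it below -/
import Mathlib

section
/- Let C be a pseudo-Yamanouchi pipe dream of size n, and suppose C′ is obtained from C by a simple slide: there are r ≥ 2 and c ≥ 1 with (r,c) ∈ C, (r−1,c) ∉ C, (r−1,c+1) ∉ C, (r,c+1) ∉ C, (r−1)+(c+1) ≤ n, and C′ = (C \ {(r,c)}) ∪ {(r−1,c+1)}. Then C′ is pseudo-Yamanouchi. -/
/-- `C` is a pipe dream of size `n`: a set of cross positions `(i,j)` in the
staircase `{(i,j) : i ≥ 1, j ≥ 1, i + j ≤ n}`. -/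
def IsPipeDream (n : ℕ) (C : Finset (ℕ × ℕ)) : Prop :=
  ∀ p ∈ C, 1 ≤ p.1 ∧ 1 ≤ p.2 ∧ p.1 + p.2 ≤ n

/-- The reading word of a pipe dream: scan rows `i = n-1, …, 1` from bottom to top,
within each row scan columns `j` in increasing order, and record `i + j - 1`
for each cross `(i,j) ∈ C`.  (Here row `r+1` for `r = n-2, …, 0` and column `c+1`,
recording `(r+1) + (c+1) - 1 = r + c + 1`.) -/
def readingWord (n : ℕ) (C : Finset (ℕ × ℕ)) : List ℕ :=
  (List.range (n - 1)).reverse.flatMap fun r =>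
    (List.range n).filterMap fun c =>
      if (r + 1, c + 1) ∈ C then some (r + c + 1) else none

/-- `C` is pseudo-Yamanouchi: for every prefix of the reading word and every
`1 ≤ j ≤ n - 2`, the number of occurrences of `j+1` is at most `1` plus the
number of occurrences of `j`. -/
def PseudoYamanouchi (n : ℕ) (C : Finset (ℕ × ℕ)) : Prop :=
  ∀ k j : ℕ, 1 ≤ j → j ≤ n - 2 →
    ((readingWord n C).take k).count (j + 1) ≤ 1 + ((readingWord n C).take k).count j

/-- `C` satisfies the TSSCPP inequalities: with `y` the 0-1 indicator of `C`,
for all `1 ≤ i < j ≤ n-1`, `1 + Σ_{k=1}^{i} y_{j-k,k} ≥ Σ_{k=1}^{i+1} y_{j-k+1,k}`. -/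
def SatisfiesTSSCPP (n : ℕ) (C : Finset (ℕ × ℕ)) : Prop :=
  ∀ i j : ℕ, 1 ≤ i → i < j → j ≤ n - 1 →
    (∑ k ∈ Finset.Icc 1 (i + 1), if (j - k + 1, k) ∈ C then (1 : ℕ) else 0) ≤
      1 + ∑ k ∈ Finset.Icc 1 i, if (j - k, k) ∈ C then (1 : ℕ) else 0

/-- Moving a letter `a` to the right past a block that avoids `a + 1` preserves the
pseudo-Yamanouchi inequality for all prefixes. -/
theorem count_take_le_of_move_right {u v t : List ℕ} {a j : ℕ} (hv : a + 1 ∉ v)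
    (h : ∀ k, ((u ++ a :: (v ++ t)).take k).count (j + 1) ≤
      1 + ((u ++ a :: (v ++ t)).take k).count j) (k : ℕ) :
    ((u ++ (v ++ a :: t)).take k).count (j + 1) ≤
      1 + ((u ++ (v ++ a :: t)).take k).count j := by
  rcases le_or_gt k u.length with hk | hk
  · simpa [List.take_append_of_le_length hk] using h k
  obtain ⟨p, rfl⟩ := Nat.exists_eq_add_of_le hk.le
  rcases le_or_gt p v.length with hp | hp
  · have hu := h u.length
    have hw := h (u.length + (p + 1))
    simp only [List.take_length_add_append, List.take_succ_cons, List.take_left,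
      List.take_append_of_le_length hp, List.count_append, List.count_cons] at hu hw ⊢
    by_cases hja : j = a
    · subst hja
      have : (v.take p).count (j + 1) = 0 :=
        List.count_eq_zero.2 fun hm => hv (List.mem_of_mem_take hm)
      omega
    · have hne : (a == j) = false := by simpa using Ne.symm hja
      simp only [hne] at hw
      simp at hw
      omega
  · obtain ⟨q, rfl⟩ := Nat.exists_eq_add_of_lt hp
    have hw := h (u.length + (v.length + q + 1))
    simp only [List.take_length_add_append, List.take_succ_cons, List.count_append,
      List.count_cons, add_assoc v.length q 1] at hw ⊢
    rw [← add_assoc v.length q 1] at hw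
    simp only [List.take_succ_cons, List.take_length_add_append, List.count_append,
      List.count_cons] at hw
    omega

/-- The part of the reading word coming from row `i + 1` and the columns `j + 1`, `j ∈ l`. -/
def rowWord (C : Finset (ℕ × ℕ)) (i : ℕ) (l : List ℕ) : List ℕ :=
  l.filterMap fun j => if (i + 1, j + 1) ∈ C then some (i + j + 1) else none

theorem rowWord_append (C : Finset (ℕ × ℕ)) (i : ℕ) (l l' : List ℕ) :
    rowWord C i (l ++ l') = rowWord C i l ++ rowWord C i l' :=
  List.filterMap_append

theorem rowWord_cons (C : Finset (ℕ × ℕ)) (i j : ℕ) (l : List ℕ) :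
    rowWord C i (j :: l) =
      if (i + 1, j + 1) ∈ C then (i + j + 1) :: rowWord C i l else rowWord C i l := by
  unfold rowWord
  split_ifs with h <;> simp [h]

theorem rowWord_congr {C D : Finset (ℕ × ℕ)} {i : ℕ} {l : List ℕ}
    (h : ∀ j ∈ l, (i + 1, j + 1) ∈ C ↔ (i + 1, j + 1) ∈ D) :
    rowWord C i l = rowWord D i l :=
  List.filterMap_congr fun j hj => by simp only [h j hj]

theorem exists_of_mem_rowWord {C : Finset (ℕ × ℕ)} {i x : ℕ} {l : List ℕ}
    (h : x ∈ rowWord C i l) : ∃ j ∈ l, x = i + j + 1 := by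
  obtain ⟨j, hj, hx⟩ := List.mem_filterMap.1 h
  split_ifs at hx
  exact ⟨j, hj, (Option.some.inj hx).symm⟩

theorem range_add_two_add (a b : ℕ) :
    List.range (a + 2 + b) =
      List.range a ++ a :: (a + 1) :: (List.range b).map (a + 2 + ·) := by
  simp [List.range_add, List.range_succ]

/-- The reading word, split at rows `R + 2` and `R + 1`. -/
theorem readingWord_split (C : Finset (ℕ × ℕ)) (n R b : ℕ) (hn : n - 1 = R + 2 + b) :
    readingWord n C =
      ((List.range b).map (R + 2 + ·)).reverse.flatMap (fun i => rowWord C i (List.range n)) ++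
        (rowWord C (R + 1) (List.range n) ++ (rowWord C R (List.range n) ++
          (List.range R).reverse.flatMap fun i => rowWord C i (List.range n))) := by
  change (List.range (n - 1)).reverse.flatMap (fun i => rowWord C i (List.range n)) = _
  rw [hn, range_add_two_add]
  simp [List.flatMap_append, List.flatMap_cons]

/-- A simple slide (moving a cross from `(r,c)` to `(r-1,c+1)` when the positions
`(r-1,c)`, `(r-1,c+1)`, `(r,c+1)` carry no cross and `(r-1,c+1)` lies in the
staircase) preserves the pseudo-Yamanouchi property. -/
theorem pseudoYamanouchi_of_simpleSlide (n : ℕ) (C C' : Finset (ℕ × ℕ))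
    (hPD : IsPipeDream n C) (hY : PseudoYamanouchi n C)
    (r c : ℕ) (hr : 2 ≤ r) (hc : 1 ≤ c)
    (hmem : (r, c) ∈ C)
    (h1 : (r - 1, c) ∉ C) (h2 : (r - 1, c + 1) ∉ C) (h3 : (r, c + 1) ∉ C)
    (hstair : (r - 1) + (c + 1) ≤ n)
    (hC' : C' = insert (r - 1, c + 1) (C.erase (r, c))) :
    PseudoYamanouchi n C' := by
  obtain ⟨R, rfl⟩ := Nat.exists_eq_add_of_le' hr
  obtain ⟨K, rfl⟩ := Nat.exists_eq_add_of_le' hc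
  have hrc : R + 2 + (K + 1) ≤ n := (hPD _ hmem).2.2
  obtain ⟨b, hb⟩ : ∃ b, n - 1 = R + 2 + b := ⟨n - 1 - (R + 2), by omega⟩
  obtain ⟨m, hm⟩ : ∃ m, n = K + 2 + m := ⟨n - (K + 2), by omega⟩
  have hRR : R + 2 - 1 = R + 1 := rfl
  rw [hRR] at h1 h2 hC'
  have hiff : ∀ i j, (i ≠ R + 1 ∨ j ≠ K) → (i ≠ R ∨ j ≠ K + 1) →
      ((i + 1, j + 1) ∈ C' ↔ (i + 1, j + 1) ∈ C) := by
    intro i j hij hij'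
    simp only [hC', Finset.mem_insert, Finset.mem_erase, Prod.mk.injEq, ne_eq]
    constructor
    · rintro (h | h)
      · omega
      · exact h.2
    · exact fun h => Or.inr ⟨by omega, h⟩
  have hold : (R + 1 + 1, K + 1) ∉ C' := by
    simp [hC']
  have hnew : (R + 1, K + 1 + 1) ∈ C' := by simp [hC']
  have hnext : (R + 1 + 1, K + 1 + 1) ∉ C' := by
    rw [hiff _ _ (by omega) (by omega)]
    exact h3
  have hcols := range_add_two_add K m
  rw [← hm] at hcols
  set L := (List.range m).map (K + 2 + ·) with hL
  have hLK : ∀ j ∈ L, K + 2 ≤ j := by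
    intro j hj
    obtain ⟨x, -, rfl⟩ := List.mem_map.1 hj
    omega
  have hrow : ∀ i, i ≠ R → i ≠ R + 1 →
      rowWord C' i (List.range n) = rowWord C i (List.range n) := fun i hi hi' =>
    rowWord_congr fun j _ => hiff i j (Or.inl hi') (Or.inl hi)
  set P := ((List.range b).map (R + 2 + ·)).reverse.flatMap
    (fun i => rowWord C i (List.range n)) with hP
  set Q := (List.range R).reverse.flatMap (fun i => rowWord C i (List.range n)) with hQ
  have hP' : ((List.range b).map (R + 2 + ·)).reverse.flatMap
      (fun i => rowWord C' i (List.range n)) = P := by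
    refine List.flatMap_congr fun i hi => ?_
    obtain ⟨x, -, rfl⟩ := List.mem_map.1 (List.mem_reverse.1 hi)
    exact hrow _ (by omega) (by omega)
  have hQ' : (List.range R).reverse.flatMap (fun i => rowWord C' i (List.range n)) = Q := by
    refine List.flatMap_congr fun i hi => ?_
    have := List.mem_range.1 (List.mem_reverse.1 hi)
    exact hrow _ (by omega) (by omega)
  have hleft : ∀ i, rowWord C' i (List.range K) = rowWord C i (List.range K) := fun i =>
    rowWord_congr fun j hj => by
      have := List.mem_range.1 hj
      exact hiff i j (by omega) (by omega)
  have hright : ∀ i, rowWord C' i L = rowWord C i L := fun i =>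
    rowWord_congr fun j hj => by
      have := hLK j hj
      exact hiff i j (by omega) (by omega)
  have hcell : (R + 1, K + 1) ∉ C' := by
    rw [hiff _ _ (by omega) (by omega)]
    exact h1
  have hw : readingWord n C = (P ++ rowWord C (R + 1) (List.range K)) ++
      (R + K + 2) :: ((rowWord C (R + 1) L ++ rowWord C R (List.range K)) ++
        (rowWord C R L ++ Q)) := by
    have ha : R + 1 + K + 1 = R + K + 2 := by omega
    rw [readingWord_split C n R b hb, ← hP, ← hQ, hcols]
    simp only [rowWord_append, rowWord_cons, if_pos hmem, if_neg h1, if_neg h2, if_neg h3, ha,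
      List.append_assoc, List.cons_append]
  have hw' : readingWord n C' = (P ++ rowWord C (R + 1) (List.range K)) ++
      ((rowWord C (R + 1) L ++ rowWord C R (List.range K)) ++
        (R + K + 2) :: (rowWord C R L ++ Q)) := by
    have ha : R + (K + 1) + 1 = R + K + 2 := by omega
    rw [readingWord_split C' n R b hb, hP', hQ', hcols]
    simp only [rowWord_append, rowWord_cons, if_neg hold, if_neg hcell, if_pos hnew,
      if_neg hnext, hleft, hright, ha, List.append_assoc, List.cons_append]
  intro k j hj hjn
  rw [hw']
  refine count_take_le_of_move_right ?_ (fun k => hw ▸ hY k j hj hjn) k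
  rw [List.mem_append]
  rintro (h | h)
  · obtain ⟨x, hx, he⟩ := exists_of_mem_rowWord h
    have := hLK x hx
    omega
  · obtain ⟨x, hx, he⟩ := exists_of_mem_rowWord h
    have := List.mem_range.1 hx
    omega
end

section
/- Let π be a permutation of {1,…,n} that avoids the pattern 1432, and let B₁ and B₂ be connected components of the Rothe diagram D(π), neither containing the cell (1,1), with essential boxes (i₁,j₁) ∈ ess(π) ∩ B₁ and (i₂,j₂) ∈ ess(π) ∩ B₂. If B₁ and B₂ both contain a cell in some common row r, then i₁ = i₂. If B₁ and B₂ both contain a cell in some common column c, then j₁ = j₂. -/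
/-- The Rothe diagram of a permutation `π` of `{1,…,n}` (formalized as a
permutation of `ℕ` fixing everything outside `{1,…,n}`):
`D(π) = {(i,j) ∈ {1,…,n}² : j < π(i) and i < π⁻¹(j)}`. -/
def RotheDiagram (n : ℕ) (π : Equiv.Perm ℕ) : Set (ℕ × ℕ) :=
  {p : ℕ × ℕ | 1 ≤ p.1 ∧ p.1 ≤ n ∧ 1 ≤ p.2 ∧ p.2 ≤ n ∧ p.2 < π p.1 ∧ p.1 < π.symm p.2}

/-- The essential boxes of `π`: cells `(i,j)` of the Rothe diagram such that
neither `(i+1,j)` nor `(i,j+1)` lies in the Rothe diagram. -/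
def EssentialBoxes (n : ℕ) (π : Equiv.Perm ℕ) : Set (ℕ × ℕ) :=
  {p : ℕ × ℕ | p ∈ RotheDiagram n π ∧ (p.1 + 1, p.2) ∉ RotheDiagram n π ∧
    (p.1, p.2 + 1) ∉ RotheDiagram n π}

/-- Adjacency of cells of the Rothe diagram: two cells of `D(π)` are adjacent
if they agree in one coordinate and differ by exactly `1` in the other. -/
def RotheAdj (n : ℕ) (π : Equiv.Perm ℕ) (p q : ℕ × ℕ) : Prop :=
  p ∈ RotheDiagram n π ∧ q ∈ RotheDiagram n π ∧
    ((p.1 = q.1 ∧ (p.2 + 1 = q.2 ∨ q.2 + 1 = p.2)) ∨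
      (p.2 = q.2 ∧ (p.1 + 1 = q.1 ∨ q.1 + 1 = p.1)))

/-- `B` is a connected component of the Rothe diagram of `π`: the set of cells
connected to some cell `p` of `D(π)` by the reflexive-transitive closure of
adjacency. -/
def IsRotheComponent (n : ℕ) (π : Equiv.Perm ℕ) (B : Set (ℕ × ℕ)) : Prop :=
  ∃ p ∈ RotheDiagram n π, B = {q | Relation.ReflTransGen (RotheAdj n π) p q}

/-- The dominant region of `D(π)`: the connected component of the cell `(1,1)`
(empty if `(1,1) ∉ D(π)`). -/
def DominantRegion (n : ℕ) (π : Equiv.Perm ℕ) : Set (ℕ × ℕ) :=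
  {q | (1, 1) ∈ RotheDiagram n π ∧ Relation.ReflTransGen (RotheAdj n π) (1, 1) q}

/-- `π` avoids the pattern 1432: there are no `a < b < c < d` in `{1,…,n}` with
`π a < π d < π c < π b`. -/
def Avoids1432 (n : ℕ) (π : Equiv.Perm ℕ) : Prop :=
  ¬ ∃ a b c d : ℕ, 1 ≤ a ∧ a < b ∧ b < c ∧ c < d ∧ d ≤ n ∧
      π a < π d ∧ π d < π c ∧ π c < π b

/-- `π` avoids the pattern 2143: there are no `a < b < c < d` in `{1,…,n}` with
`π b < π a < π d < π c`. -/
def Avoids2143 (n : ℕ) (π : Equiv.Perm ℕ) : Prop :=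
  ¬ ∃ a b c d : ℕ, 1 ≤ a ∧ a < b ∧ b < c ∧ c < d ∧ d ≤ n ∧
      π b < π a ∧ π a < π d ∧ π d < π c

/-- `π` is Grassmannian: it has at most one descent, i.e. at most one index `i`
in `{1,…,n}` with `π (i+1) < π i`. -/
def IsGrassmannian (n : ℕ) (π : Equiv.Perm ℕ) : Prop :=
  ((Finset.Icc 1 n).filter fun i => π (i + 1) < π i).card ≤ 1

open Relation

lemma RotheAdj.symm {n : ℕ} {π : Equiv.Perm ℕ} {p q : ℕ × ℕ} (h : RotheAdj n π p q) :
    RotheAdj n π q p := by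
  obtain ⟨hp, hq, h⟩ := h
  exact ⟨hq, hp, by omega⟩

lemma rotheReachable_symm {n : ℕ} {π : Equiv.Perm ℕ} {p q : ℕ × ℕ}
    (h : ReflTransGen (RotheAdj n π) p q) : ReflTransGen (RotheAdj n π) q p := by
  have : Std.Symm (RotheAdj n π) := ⟨fun _ _ => RotheAdj.symm⟩
  exact ReflTransGen.stdSymm.symm _ _ h

lemma perm_apply_pos {n : ℕ} {π : Equiv.Perm ℕ} (hπ : ∀ m : ℕ, m = 0 ∨ n < m → π m = m)
    {a : ℕ} (ha : 1 ≤ a) : 1 ≤ π a := by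
  by_contra h
  have : π a = π 0 := by rw [hπ 0 (Or.inl rfl)]; omega
  have := π.injective this
  omega

lemma perm_symm_fixes {n : ℕ} {π : Equiv.Perm ℕ} (hπ : ∀ m : ℕ, m = 0 ∨ n < m → π m = m)
    (m : ℕ) (hm : m = 0 ∨ n < m) : π.symm m = m := by
  rw [Equiv.symm_apply_eq, hπ m hm]

lemma perm_apply_le {n : ℕ} {π : Equiv.Perm ℕ} (hπ : ∀ m : ℕ, m = 0 ∨ n < m → π m = m)
    {a : ℕ} (ha : a ≤ n) : π a ≤ n := by
  by_contra h
  have := perm_symm_fixes hπ (π a) (Or.inr (by omega))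
  rw [Equiv.symm_apply_apply] at this
  omega

/-- If the whole rectangle between `(1,1)` and `(i,j)` lies in the Rothe diagram, then its
corners are connected. -/
lemma rotheReachable_one_one_of_rectangle {n : ℕ} {π : Equiv.Perm ℕ} {i j : ℕ}
    (hi : 1 ≤ i) (hj : 1 ≤ j)
    (h : ∀ a b, 1 ≤ a → a ≤ i → 1 ≤ b → b ≤ j → (a, b) ∈ RotheDiagram n π) :
    ReflTransGen (RotheAdj n π) (i, j) (1, 1) := by
  have hrow : ReflTransGen (RotheAdj n π) (i, 1) (1, 1) := by
    induction i, hi using Nat.le_induction with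
    | base => exact .refl
    | succ k hk ih =>
      refine .head ⟨h _ _ (by omega) le_rfl le_rfl hj, h k 1 hk (by omega) le_rfl hj, ?_⟩
        (ih fun a b ha ha' hb hb' => h a b ha (by omega) hb hb')
      simp
  refine ReflTransGen.trans ?_ hrow
  clear hrow
  induction j, hj using Nat.le_induction with
  | base => exact .refl
  | succ k hk ih =>
    refine .head ⟨h _ _ hi le_rfl (by omega) le_rfl, h i k hi le_rfl hk (by omega), ?_⟩
      (ih fun a b ha ha' hb hb' => h a b ha ha' hb (by omega))
    simp

/-- A cell outside the dominant region has a point of the permutation strictly northwest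
of it. -/
lemma exists_northwest_of_not_dominant {n : ℕ} {π : Equiv.Perm ℕ}
    (hπ : ∀ m : ℕ, m = 0 ∨ n < m → π m = m) {i j : ℕ} (hq : (i, j) ∈ RotheDiagram n π)
    (hd : ¬ ReflTransGen (RotheAdj n π) (i, j) (1, 1)) :
    ∃ a, 1 ≤ a ∧ a < i ∧ π a < j := by
  obtain ⟨hi, hin, hj, hjn, hji, hij⟩ := hq
  dsimp only at *
  by_contra! hno
  refine hd (rotheReachable_one_one_of_rectangle hi hj fun a b ha hai hb hbj => ?_)
  have key : ∀ x, 1 ≤ x → x ≤ i → j < π x := by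
    intro x hx hxi
    rcases hxi.lt_or_eq with hlt | rfl
    · refine lt_of_le_of_ne (hno x hx hlt) fun he => ?_
      rw [he, Equiv.symm_apply_apply] at hij
      omega
    · exact hji
  refine ⟨ha, hai.trans hin, hb, hbj.trans hjn, hbj.trans_lt (key a ha hai), ?_⟩
  dsimp only
  by_contra! hle
  have := key (π.symm b) (perm_apply_pos (perm_symm_fixes hπ) hb) (hle.trans hai)
  rw [Equiv.apply_symm_apply] at this
  omega

/-- For a cell outside the dominant region of a 1432-avoiding permutation, the cell below
lies in the diagram exactly when the permutation ascends at the row of the cell. -/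
lemma below_mem_iff_ascent {n : ℕ} {π : Equiv.Perm ℕ}
    (hπ : ∀ m : ℕ, m = 0 ∨ n < m → π m = m) (hav : Avoids1432 n π) {i j : ℕ}
    (hq : (i, j) ∈ RotheDiagram n π)
    (hd : ¬ ReflTransGen (RotheAdj n π) (i, j) (1, 1)) :
    (i + 1, j) ∈ RotheDiagram n π ↔ π i < π (i + 1) := by
  obtain ⟨a, ha, hai, haj⟩ := exists_northwest_of_not_dominant hπ hq hd
  obtain ⟨hi, hin, hj, hjn, hji, hij⟩ := hq
  dsimp only at *
  have hjs : π.symm j ≤ n := perm_apply_le (perm_symm_fixes hπ) hjn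
  have hpj : π (π.symm j) = j := π.apply_symm_apply j
  constructor
  · rintro ⟨-, -, -, -, h1, h2⟩
    dsimp only at h1 h2
    by_contra hna
    have hne : π (i + 1) ≠ π i := fun h => by have := π.injective h; omega
    exact hav ⟨a, i, i + 1, π.symm j, ha, hai, by omega, h2, hjs, by omega, by omega, by omega⟩
  · intro hasc
    have hne : π.symm j ≠ i + 1 := fun h => by rw [h] at hpj; omega
    exact ⟨by simp, by dsimp only; omega, hj, hjn, by dsimp only; omega, by dsimp only; omega⟩

/-- `e` is the last row of the maximal ascending run of `π` through row `i`. -/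
def IsAscendingRunEnd (π : Equiv.Perm ℕ) (i e : ℕ) : Prop :=
  i ≤ e ∧ (∀ k, i ≤ k → k < e → π k < π (k + 1)) ∧ ¬ π e < π (e + 1)

lemma IsAscendingRunEnd.unique {π : Equiv.Perm ℕ} {i e e' : ℕ}
    (h : IsAscendingRunEnd π i e) (h' : IsAscendingRunEnd π i e') : e = e' := by
  rcases lt_trichotomy e e' with hlt | heq | hlt
  · exact absurd (h'.2.1 e h.1 hlt) h.2.2
  · exact heq
  · exact absurd (h.2.1 e' h'.1 hlt) h'.2.2

lemma isAscendingRunEnd_succ_iff {π : Equiv.Perm ℕ} {i e : ℕ} (h : π i < π (i + 1)) :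
    IsAscendingRunEnd π (i + 1) e ↔ IsAscendingRunEnd π i e := by
  constructor
  · rintro ⟨h1, h2, h3⟩
    refine ⟨by omega, fun k hk hke => ?_, h3⟩
    rcases hk.eq_or_lt with rfl | hlt
    · exact h
    · exact h2 k hlt hke
  · rintro ⟨h1, h2, h3⟩
    have : i ≠ e := by rintro rfl; exact h3 h
    exact ⟨by omega, fun k hk hke => h2 k (by omega) hke, h3⟩

lemma essential_row_isAscendingRunEnd {n : ℕ} {π : Equiv.Perm ℕ}
    (hπ : ∀ m : ℕ, m = 0 ∨ n < m → π m = m) (hav : Avoids1432 n π) {e x : ℕ × ℕ}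
    (he : e ∈ EssentialBoxes n π)
    (hd : ¬ ReflTransGen (RotheAdj n π) e (1, 1))
    (hx : ReflTransGen (RotheAdj n π) e x) : IsAscendingRunEnd π x.1 e.1 := by
  induction hx with
  | refl =>
    exact ⟨le_rfl, fun k hk hke => by omega,
      fun h => he.2.1 ((below_mem_iff_ascent hπ hav he.1 hd).2 h)⟩
  | @tail y z hy hyz ih =>
    have hyd : ¬ ReflTransGen (RotheAdj n π) y (1, 1) := fun h => hd (hy.trans h)
    have hzd : ¬ ReflTransGen (RotheAdj n π) z (1, 1) := fun h => hyd (.head hyz h)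
    obtain ⟨y1, y2⟩ := y
    obtain ⟨z1, z2⟩ := z
    obtain ⟨hyD, hzD, hadj⟩ := hyz
    dsimp only at *
    rcases hadj with ⟨rfl, -⟩ | ⟨rfl, rfl | rfl⟩
    · exact ih
    · exact (isAscendingRunEnd_succ_iff ((below_mem_iff_ascent hπ hav hyD hyd).1 hzD)).2 ih
    · exact (isAscendingRunEnd_succ_iff ((below_mem_iff_ascent hπ hav hzD hzd).1 hyD)).1 ih

lemma IsRotheComponent.reachable {n : ℕ} {π : Equiv.Perm ℕ} {B : Set (ℕ × ℕ)}
    (hB : IsRotheComponent n π B) {x : ℕ × ℕ} (hx : x ∈ B) (y : ℕ × ℕ) :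
    y ∈ B ↔ ReflTransGen (RotheAdj n π) x y := by
  obtain ⟨p, -, rfl⟩ := hB
  exact ⟨fun hy => (rotheReachable_symm hx).trans hy, fun h => ReflTransGen.trans hx h⟩

lemma essential_rows_eq {n : ℕ} {π : Equiv.Perm ℕ}
    (hπ : ∀ m : ℕ, m = 0 ∨ n < m → π m = m) (hav : Avoids1432 n π) {e f x y : ℕ × ℕ}
    (he : e ∈ EssentialBoxes n π) (hf : f ∈ EssentialBoxes n π)
    (hed : ¬ ReflTransGen (RotheAdj n π) e (1, 1))
    (hfd : ¬ ReflTransGen (RotheAdj n π) f (1, 1))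
    (hx : ReflTransGen (RotheAdj n π) e x) (hy : ReflTransGen (RotheAdj n π) f y)
    (hxy : x.1 = y.1) : e.1 = f.1 :=
  (essential_row_isAscendingRunEnd hπ hav he hed hx).unique
    (hxy ▸ essential_row_isAscendingRunEnd hπ hav hf hfd hy)

lemma swap_mem_rotheDiagram_symm {n : ℕ} {π : Equiv.Perm ℕ} {p : ℕ × ℕ} :
    p.swap ∈ RotheDiagram n π.symm ↔ p ∈ RotheDiagram n π := by
  simp only [RotheDiagram, Set.mem_ofPred_eq, Prod.fst_swap, Prod.snd_swap, Equiv.symm_symm]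
  tauto

lemma swap_mem_essentialBoxes_symm {n : ℕ} {π : Equiv.Perm ℕ} {p : ℕ × ℕ}
    (h : p ∈ EssentialBoxes n π) : p.swap ∈ EssentialBoxes n π.symm :=
  ⟨swap_mem_rotheDiagram_symm.2 h.1,
    fun h' => h.2.2 (swap_mem_rotheDiagram_symm.1 h'),
    fun h' => h.2.1 (swap_mem_rotheDiagram_symm.1 h')⟩

lemma RotheAdj.swap {n : ℕ} {π : Equiv.Perm ℕ} {p q : ℕ × ℕ} (h : RotheAdj n π p q) :
    RotheAdj n π.symm p.swap q.swap :=
  ⟨swap_mem_rotheDiagram_symm.2 h.1, swap_mem_rotheDiagram_symm.2 h.2.1, h.2.2.symm⟩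

lemma rotheReachable_swap {n : ℕ} {π : Equiv.Perm ℕ} {p q : ℕ × ℕ}
    (h : ReflTransGen (RotheAdj n π) p q) :
    ReflTransGen (RotheAdj n π.symm) p.swap q.swap :=
  ReflTransGen.lift Prod.swap (fun _ _ => RotheAdj.swap) _ _ h

lemma Avoids1432.symm {n : ℕ} {π : Equiv.Perm ℕ}
    (hπ : ∀ m : ℕ, m = 0 ∨ n < m → π m = m) (hav : Avoids1432 n π) :
    Avoids1432 n π.symm := by
  rintro ⟨a, b, c, d, ha, hab, hbc, hcd, hdn, had, hdc, hcb⟩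
  refine hav ⟨π.symm a, π.symm d, π.symm c, π.symm b,
    perm_apply_pos (perm_symm_fixes hπ) ha, had, hdc, hcb,
    perm_apply_le (perm_symm_fixes hπ) (by omega), ?_⟩
  simp only [Equiv.apply_symm_apply]
  exact ⟨hab, hbc, hcd⟩

/-- If `π` avoids 1432 and `B₁`, `B₂` are connected components of `D(π)` not
containing `(1,1)`, with essential boxes `(i₁,j₁) ∈ B₁` and `(i₂,j₂) ∈ B₂`:
if `B₁` and `B₂` both contain a cell in a common row then `i₁ = i₂`, and if they
both contain a cell in a common column then `j₁ = j₂`. -/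
theorem components_aligned_of_avoids1432 (n : ℕ) (π : Equiv.Perm ℕ)
    (hπ : ∀ m : ℕ, m = 0 ∨ n < m → π m = m)
    (hav : Avoids1432 n π)
    (B₁ B₂ : Set (ℕ × ℕ))
    (hB₁ : IsRotheComponent n π B₁) (hB₂ : IsRotheComponent n π B₂)
    (hdom₁ : (1, 1) ∉ B₁) (hdom₂ : (1, 1) ∉ B₂)
    (i₁ j₁ i₂ j₂ : ℕ)
    (he₁ : (i₁, j₁) ∈ EssentialBoxes n π ∧ (i₁, j₁) ∈ B₁)
    (he₂ : (i₂, j₂) ∈ EssentialBoxes n π ∧ (i₂, j₂) ∈ B₂) :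
    ((∃ r c c' : ℕ, (r, c) ∈ B₁ ∧ (r, c') ∈ B₂) → i₁ = i₂) ∧
    ((∃ c r r' : ℕ, (r, c) ∈ B₁ ∧ (r', c) ∈ B₂) → j₁ = j₂) := by
  rw [hB₁.reachable he₁.2] at hdom₁
  rw [hB₂.reachable he₂.2] at hdom₂
  constructor
  · rintro ⟨r, c, c', h₁, h₂⟩
    exact essential_rows_eq hπ hav he₁.1 he₂.1 hdom₁ hdom₂
      ((hB₁.reachable he₁.2 _).1 h₁) ((hB₂.reachable he₂.2 _).1 h₂) rfl
  · rintro ⟨c, r, r', h₁, h₂⟩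
    exact essential_rows_eq (perm_symm_fixes hπ) (hav.symm hπ)
      (swap_mem_essentialBoxes_symm he₁.1) (swap_mem_essentialBoxes_symm he₂.1)
      (fun h => hdom₁ (rotheReachable_swap h)) (fun h => hdom₂ (rotheReachable_swap h))
      (rotheReachable_swap ((hB₁.reachable he₁.2 _).1 h₁))
      (rotheReachable_swap ((hB₂.reachable he₂.2 _).1 h₂)) rfl
end
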